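/- Let m ≥ 1 and N ≥ 2 be integers and let p be a real number with 1 < p ≤ N − 1. Suppose f_1,…,f_m satisfy (C1)–(C3), and suppose b_1,…,b_m : [0,∞) → [0,∞) are continuous functions such that for some ε > 0 one has ∫_0^∞ t^{1+ε} (Σ_{j=1}^m b_j(t))^{2/p} dt < ∞ and such that r ↦ r^{p(N−1)/(p−1)} Σ_{j=1}^m b_j(r) is nondecreasing for all sufficiently large r. Then there exists a radial solution (w_1,…,w_m) of the system with coefficients b_1,…,b_m and initial value β = 1/m, each component w_i being continuous, nondecreasing, satisfying w_i(r) ≥ 1/m for all r ≥ 0, and bounded on [0,∞). -/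

import Mathlib

open Real MeasureTheory Filter Set intervalIntegral

/-- `F(s) = ∫_0^s Σ_{i=1}^m f_i(t,…,t) dt`. -/
noncomputable def Fsum (m : ℕ) (f : Fin m → (Fin m → ℝ) → ℝ) (s : ℝ) : ℝ :=
  ∫ t in (0:ℝ)..s, ∑ i, f i (fun _ => t)

/-- Conditions (C1)–(C2): each `f j` maps `[0,∞)^m` to `[0,∞)`, is continuously
differentiable in each variable, vanishes at the origin, is positive when all
arguments are positive, and is nondecreasing in each variable. -/
def SatC12 (m : ℕ) (f : Fin m → (Fin m → ℝ) → ℝ) : Prop :=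
  (∀ j (i : Fin m) (s : Fin m → ℝ), (∀ l, 0 ≤ s l) →
    ContDiffOn ℝ 1 (fun t => f j (Function.update s i t)) (Set.Ici 0)) ∧
  (∀ j s, (∀ l, 0 ≤ s l) → 0 ≤ f j s) ∧
  (∀ j, f j (fun _ => 0) = 0) ∧
  (∀ j s, (∀ l, 0 < s l) → 0 < f j s) ∧
  (∀ j s t, (∀ l, 0 ≤ s l) → (∀ l, s l ≤ t l) → f j s ≤ f j t)

/-- Condition (C3): `∫_1^∞ F(s)^(-1/p) ds = ∞`. -/
def SatC3 (m : ℕ) (p : ℝ) (f : Fin m → (Fin m → ℝ) → ℝ) : Prop :=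
  Tendsto (fun r => ∫ s in (1:ℝ)..r, (Fsum m f s) ^ (-1/p)) atTop atTop

/-- A radial solution of the system with coefficients `b` and initial value `β`:
`w i r = β + ∫_0^r (t^(1-N) ∫_0^t s^(N-1) b i s · f i (w₁(s),…,w_m(s)) ds)^(1/(p-1)) dt`. -/
def IsRadialSolution (m N : ℕ) (p : ℝ) (b : Fin m → ℝ → ℝ)
    (f : Fin m → (Fin m → ℝ) → ℝ) (β : ℝ) (w : Fin m → ℝ → ℝ) : Prop :=
  (∀ i, ContinuousOn (w i) (Set.Ici 0)) ∧
  (∀ i r, 0 ≤ r → 0 ≤ w i r) ∧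
  (∀ i r, 0 ≤ r → w i r = β + ∫ t in (0:ℝ)..r,
      (t ^ (1 - (N:ℝ)) * ∫ s in (0:ℝ)..t,
        s ^ ((N:ℝ) - 1) * b i s * f i (fun j => w j s)) ^ (1/(p-1)))


noncomputable def Yf (n : ℝ) (g : ℝ → ℝ) (t : ℝ) : ℝ := ∫ s in (0:ℝ)..t, (max s 0) ^ n * g s

noncomputable def phiF (n a : ℝ) (g : ℝ → ℝ) (t : ℝ) : ℝ := ((max t 0) ^ (-n) * Yf n g t) ^ a

lemma Yint_cont {n : ℝ} (hn : 0 < n) {g : ℝ → ℝ} (hg : Continuous g) :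
    Continuous (fun s : ℝ => (max s 0) ^ n * g s) :=
  ((continuous_id.max continuous_const).rpow_const (fun _ => Or.inr hn.le)).mul hg

lemma Yf_deriv {n : ℝ} (hn : 0 < n) {g : ℝ → ℝ} (hg : Continuous g) (t : ℝ) :
    HasDerivAt (Yf n g) ((max t 0) ^ n * g t) t :=
  (Yint_cont hn hg).integral_hasStrictDerivAt 0 t |>.hasDerivAt

lemma Yf_cont {n : ℝ} (hn : 0 < n) {g : ℝ → ℝ} (hg : Continuous g) : Continuous (Yf n g) :=
  continuous_iff_continuousAt.2 fun t => (Yf_deriv hn hg t).continuousAt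

lemma Yf_nonneg {n : ℝ} {g : ℝ → ℝ} (h0 : ∀ s, 0 ≤ g s) {t : ℝ}
    (ht : 0 ≤ t) : 0 ≤ Yf n g t :=
  intervalIntegral.integral_nonneg ht fun s _ =>
    mul_nonneg (Real.rpow_nonneg (le_max_right _ _) _) (h0 s)

lemma Yf_mono {n : ℝ} (hn : 0 < n) {g g' : ℝ → ℝ} (hg : Continuous g) (hg' : Continuous g')
    (h : ∀ s, g s ≤ g' s) {t : ℝ} (ht : 0 ≤ t) : Yf n g t ≤ Yf n g' t :=
  intervalIntegral.integral_mono_on ht ((Yint_cont hn hg).intervalIntegrable _ _)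
    ((Yint_cont hn hg').intervalIntegrable _ _) fun s _ =>
    mul_le_mul_of_nonneg_left (h s) (Real.rpow_nonneg (le_max_right _ _) _)

lemma phiF_neg {n a : ℝ} (hn : 0 < n) (ha : 0 < a) (g : ℝ → ℝ) {t : ℝ} (ht : t ≤ 0) :
    phiF n a g t = 0 := by
  unfold phiF
  rw [max_eq_right ht, Real.zero_rpow (by linarith), zero_mul, Real.zero_rpow ha.ne']

lemma phiF_nonneg {n a : ℝ} (hn : 0 < n) (ha : 0 < a) {g : ℝ → ℝ} (h0 : ∀ s, 0 ≤ g s) (t : ℝ) :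
    0 ≤ phiF n a g t := by
  rcases le_total t 0 with ht | ht
  · rw [phiF_neg hn ha g ht]
  · exact Real.rpow_nonneg (mul_nonneg (Real.rpow_nonneg (le_max_right _ _) _) (Yf_nonneg h0 ht)) _

lemma phiF_mono {n a : ℝ} (hn : 0 < n) (ha : 0 < a) {g g' : ℝ → ℝ} (hg : Continuous g)
    (hg' : Continuous g') (h0 : ∀ s, 0 ≤ g s)
    (h : ∀ s, g s ≤ g' s) (t : ℝ) : phiF n a g t ≤ phiF n a g' t := by
  rcases le_total t 0 with ht | ht
  · rw [phiF_neg hn ha g ht, phiF_neg hn ha g' ht]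
  · have h1 : (0:ℝ) ≤ (max t 0) ^ (-n) := Real.rpow_nonneg (le_max_right _ _) _
    exact Real.rpow_le_rpow (mul_nonneg h1 (Yf_nonneg h0 ht))
      (mul_le_mul_of_nonneg_left (Yf_mono hn hg hg' h ht) h1) ha.le

lemma phiF_cont {n a : ℝ} (hn : 0 < n) (ha : 0 < a) {g : ℝ → ℝ} (hg : Continuous g)
    (h0 : ∀ s, 0 ≤ g s) : Continuous (phiF n a g) := by
  have key : Continuous (fun t : ℝ => (max t 0) ^ (-n) * Yf n g t) := by
    rw [continuous_iff_continuousAt]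
    intro t
    rcases lt_trichotomy t 0 with ht | ht | ht
    · have : (fun t : ℝ => (max t 0) ^ (-n) * Yf n g t) =ᶠ[nhds t] fun _ => 0 := by
        filter_upwards [Iio_mem_nhds ht] with s hs
        rw [max_eq_right (le_of_lt hs), Real.zero_rpow (by linarith), zero_mul]
      exact continuousAt_const.congr this.symm
    · subst ht
      obtain ⟨C, hC⟩ := (isCompact_Icc (a := (0:ℝ)) (b := 1)).exists_bound_of_continuousOn
        hg.continuousOn
      have hC0 : 0 ≤ C := (norm_nonneg _).trans (hC 0 (by simp))
      have e0 : (max (0:ℝ) 0) ^ (-n) * Yf n g 0 = 0 := by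
        rw [max_self, Real.zero_rpow (by linarith), zero_mul]
      unfold ContinuousAt
      simp only [e0]
      refine squeeze_zero_norm' (a := fun t : ℝ => C * |t|) ?_ ?_
      · filter_upwards [Iio_mem_nhds (zero_lt_one (α := ℝ))] with t ht1
        rcases le_or_gt t 0 with ht | ht
        · rw [max_eq_right ht, Real.zero_rpow (by linarith), zero_mul, norm_zero]
          positivity
        · have hY : Yf n g t ≤ t ^ n * C * t := by
            have := intervalIntegral.integral_mono_on (μ := volume) ht.le
              ((Yint_cont hn hg).intervalIntegrable 0 t)
              (continuous_const (y := t ^ n * C) |>.intervalIntegrable 0 t) (fun s hs => by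
                rw [max_eq_left hs.1]
                apply mul_le_mul
                · exact Real.rpow_le_rpow hs.1 hs.2 hn.le
                · exact (le_abs_self _).trans (hC s ⟨hs.1, hs.2.trans (le_of_lt ht1)⟩)
                · exact h0 s
                · positivity)
            rw [intervalIntegral.integral_const, smul_eq_mul, sub_zero] at this
            unfold Yf
            linarith
          rw [max_eq_left ht.le, Real.norm_of_nonneg
            (mul_nonneg (Real.rpow_nonneg ht.le _) (Yf_nonneg h0 ht.le)), abs_of_pos ht]
          calc t ^ (-n) * Yf n g t ≤ t ^ (-n) * (t ^ n * C * t) := by gcongr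
            _ = (t ^ (-n) * t ^ n) * (C * t) := by ring
            _ = C * t := by rw [← Real.rpow_add ht]; simp
      · have : Continuous (fun t : ℝ => C * |t|) := by fun_prop
        simpa using this.tendsto 0
    · refine ContinuousAt.mul ?_ (Yf_cont hn hg).continuousAt
      refine ContinuousAt.rpow_const (by fun_prop) (Or.inl ?_)
      rw [max_eq_left ht.le]; exact ht.ne'
  exact key.rpow_const fun _ => Or.inr ha.le

/-- energy estimate -/
lemma energy {m : ℕ} {n p a q : ℝ} (hn : 0 < n) (hp : 1 < p) (ha : a = 1/(p-1))
    (hq : q = p * n * a) {f : Fin m → (Fin m → ℝ) → ℝ} {b : Fin m → ℝ → ℝ}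
    (fc : ∀ j, Continuous (f j)) (f0 : ∀ j s, 0 ≤ f j s) (fm : ∀ j, Monotone (f j))
    (bc : ∀ j, Continuous (b j)) (b0 : ∀ j s, 0 ≤ b j s)
    {β : ℝ} (hβ : 0 ≤ β) {v u : Fin m → ℝ → ℝ} (vc : ∀ i, Continuous (v i))
    (hu : ∀ i r, u i r = β + ∫ t in (0:ℝ)..r, phiF n a (fun s => b i s * f i (fun j => v j s)) t)
    (hvu : ∀ i r, v i r ≤ u i r) {Bt : ℝ → ℝ}
    (hBt : ∀ i s r, 0 ≤ s → s ≤ r → s ^ q * b i s ≤ r ^ q * Bt r)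
    (i : Fin m) (r : ℝ) (hr : 0 < r) :
    phiF n a (fun s => b i s * f i (fun j => v j s)) r ≤
      (p/(p-1) * (Bt r * Fsum m f (∑ i, u i r))) ^ (1/p) := by
  have hp1 : 0 < p - 1 := by linarith
  have ha0 : 0 < a := by rw [ha]; positivity
  set g : Fin m → ℝ → ℝ := fun i s => b i s * f i (fun j => v j s) with hgdef
  have gc : ∀ i, Continuous (g i) := fun i =>
    (bc i).mul ((fc i).comp (continuous_pi fun j => vc j))
  have g0 : ∀ i s, 0 ≤ g i s := fun i s => mul_nonneg (b0 i s) (f0 i _)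
  have pc : ∀ i, Continuous (phiF n a (g i)) := fun i => phiF_cont hn ha0 (gc i) (g0 i)
  have p0 : ∀ i t, 0 ≤ phiF n a (g i) t := fun i t => phiF_nonneg hn ha0 (g0 i) t
  have ud : ∀ i r, HasDerivAt (u i) (phiF n a (g i) r) r := by
    intro i r
    have : u i = fun r => β + ∫ t in (0:ℝ)..r, phiF n a (g i) t := funext (hu i)
    rw [this]
    exact ((pc i).integral_hasStrictDerivAt 0 r).hasDerivAt.const_add β
  have uβ : ∀ i r, 0 ≤ r → β ≤ u i r := by
    intro i r hr
    rw [hu i r]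
    have := intervalIntegral.integral_nonneg (μ := volume) hr fun t _ => p0 i t
    linarith
  set W : ℝ → ℝ := fun r => ∑ i, u i r with hW
  have Wd : ∀ r, HasDerivAt W (∑ i, phiF n a (g i) r) r := fun r =>
    HasDerivAt.fun_sum fun i _ => ud i r
  have uW : ∀ i r, 0 ≤ r → u i r ≤ W r := fun i r hr =>
    Finset.single_le_sum (f := fun i => u i r) (fun j _ => hβ.trans (uβ j r hr)) (Finset.mem_univ i)
  have dc : Continuous (fun t : ℝ => ∑ i, f i (fun _ => t)) := by
    refine continuous_finsetSum _ fun i _ => (fc i).comp (by fun_prop)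
  have Fd : ∀ s, HasDerivAt (Fsum m f) (∑ i, f i (fun _ => s)) s := fun s =>
    (dc.integral_hasStrictDerivAt 0 s).hasDerivAt
  have e1 : 1 + a = p / (p-1) := by rw [ha]; field_simp; ring
  set K := r ^ q * Bt r with hK
  have hK0 : 0 ≤ K := by
    have := hBt i r r hr.le le_rfl
    exact (mul_nonneg (Real.rpow_nonneg hr.le _) (b0 i r)).trans this
  have Y0 : ∀ s, 0 ≤ s → 0 ≤ Yf n (g i) s := fun s hs => Yf_nonneg (g0 i) hs
  -- difference
  let D : ℝ → ℝ := fun s => (1+a) * (K * Fsum m f (W s)) - (Yf n (g i) s) ^ (1+a)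
  have Dd : ∀ s, HasDerivAt D ((1+a) * (K * ((∑ i, f i (fun _ => W s)) * ∑ i, phiF n a (g i) s))
      - ((max s 0) ^ n * g i s) * (1+a) * (Yf n (g i) s) ^ (1+a-1)) s := by
    intro s
    have h1 := (((Fd (W s)).comp s (Wd s)).const_mul K).const_mul (1+a)
    have h2 := (Yf_deriv hn (gc i) s).rpow_const (p := 1+a) (Or.inr (by linarith))
    exact h1.sub h2
  have Dm : MonotoneOn D (Icc 0 r) := by
    apply monotoneOn_of_deriv_nonneg (convex_Icc 0 r)
    · exact fun s _ => (Dd s).continuousAt.continuousWithinAt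
    · exact fun s _ => (Dd s).differentiableAt.differentiableWithinAt
    · intro s hs
      rw [interior_Icc] at hs
      rw [(Dd s).deriv, max_eq_left hs.1.le, add_sub_cancel_left]
      have e2 : (Yf n (g i) s) ^ a = s ^ (n * a) * phiF n a (g i) s := by
        unfold phiF
        rw [max_eq_left hs.1.le, Real.mul_rpow (Real.rpow_nonneg hs.1.le _) (Y0 s hs.1.le),
          ← Real.rpow_mul hs.1.le, ← mul_assoc, ← Real.rpow_add hs.1]
        simp
      have e3 : s ^ n * s ^ (n*a) = s ^ q := by
        rw [← Real.rpow_add hs.1, hq]; congr 1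
        rw [ha]; field_simp; ring
      have e4 : s ^ n * g i s * (1+a) * (Yf n (g i) s) ^ a =
          (1+a) * ((s ^ q * b i s) * (f i (fun j => v j s) * phiF n a (g i) s)) := by
        rw [e2, ← e3]; simp only [hgdef]; ring
      rw [e4, sub_nonneg]
      apply mul_le_mul_of_nonneg_left _ (by linarith)
      apply mul_le_mul (hBt i s r hs.1.le hs.2.le) _ (mul_nonneg (f0 _ _) (p0 _ _)) hK0
      apply mul_le_mul _ _ (p0 _ _) (Finset.sum_nonneg fun j _ => f0 _ _)
      · refine le_trans (fm i (fun j => (hvu j s).trans (uW j s hs.1.le))) ?_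
        exact Finset.single_le_sum (f := fun j => f j fun _ => W s) (fun j _ => f0 _ _)
          (Finset.mem_univ i)
      · exact Finset.single_le_sum (f := fun j => phiF n a (g j) s) (fun j _ => p0 _ _)
          (Finset.mem_univ i)
  have hW0 : ∀ s, 0 ≤ s → 0 ≤ W s := fun s hs =>
    Finset.sum_nonneg fun j _ => hβ.trans (uβ j s hs)
  have F0 : ∀ s, 0 ≤ s → 0 ≤ Fsum m f s := fun s hs =>
    intervalIntegral.integral_nonneg hs fun t _ => Finset.sum_nonneg fun j _ => f0 _ _
  have hD0 : 0 ≤ D 0 := by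
    have : Yf n (g i) 0 = 0 := by simp [Yf]
    simp only [D, this]
    rw [Real.zero_rpow (by linarith), sub_zero]
    exact mul_nonneg (by linarith) (mul_nonneg hK0 (F0 _ (hW0 0 le_rfl)))
  have hDr : 0 ≤ D r := hD0.trans (Dm ⟨le_rfl, hr.le⟩ ⟨hr.le, le_rfl⟩ hr.le)
  simp only [D, sub_nonneg] at hDr
  have hphi : phiF n a (g i) r = (r ^ (-q) * (Yf n (g i) r) ^ (1+a)) ^ (1/p) := by
    unfold phiF
    rw [max_eq_left hr.le, Real.mul_rpow (Real.rpow_nonneg hr.le _) (Y0 r hr.le),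
      Real.mul_rpow (Real.rpow_nonneg hr.le _) (Real.rpow_nonneg (Y0 r hr.le) _),
      ← Real.rpow_mul hr.le, ← Real.rpow_mul hr.le, ← Real.rpow_mul (Y0 r hr.le), hq, e1, ha]
    have hp0 : p ≠ 0 := by linarith
    congr 2 <;> field_simp
  rw [hphi]
  have hrq : 0 ≤ r ^ (-q) := Real.rpow_nonneg hr.le _
  apply Real.rpow_le_rpow (mul_nonneg hrq (Real.rpow_nonneg (Y0 r hr.le) _)) _ (by positivity)
  calc r ^ (-q) * (Yf n (g i) r) ^ (1+a) ≤ r ^ (-q) * ((1+a) * (K * Fsum m f (W r))) := by gcongr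
    _ = (r ^ (-q) * r ^ q) * (p/(p-1) * (Bt r * Fsum m f (W r))) := by rw [hK, e1]; ring
    _ = _ := by rw [← Real.rpow_add hr]; simp [hW]

lemma Fsum_cont {m : ℕ} {f : Fin m → (Fin m → ℝ) → ℝ} (fc : ∀ j, Continuous (f j)) :
    Continuous (Fsum m f) := by
  have dc : Continuous (fun t : ℝ => ∑ i, f i (fun _ => t)) := by
    refine continuous_finsetSum _ fun i _ => (fc i).comp (by fun_prop)
  exact continuous_iff_continuousAt.2 fun s =>
    (dc.integral_hasStrictDerivAt 0 s).hasDerivAt.continuousAt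

lemma Fsum_pos {m : ℕ} (hm : 1 ≤ m) {f : Fin m → (Fin m → ℝ) → ℝ} (fc : ∀ j, Continuous (f j))
    (fp : ∀ j s, (∀ l, 0 < s l) → 0 < f j s) {s : ℝ} (hs : 0 < s) : 0 < Fsum m f s := by
  have dc : Continuous (fun t : ℝ => ∑ i, f i (fun _ => t)) := by
    refine continuous_finsetSum _ fun i _ => (fc i).comp (by fun_prop)
  refine intervalIntegral.intervalIntegral_pos_of_pos_on (dc.intervalIntegrable _ _) ?_ hs
  intro t ht
  have : Nonempty (Fin m) := ⟨⟨0, hm⟩⟩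
  exact Finset.sum_pos (fun i _ => fp i _ fun _ => ht.1) Finset.univ_nonempty

lemma apriori {m : ℕ} (hm : 1 ≤ m) {n p a q : ℝ} (hn : 0 < n) (hp : 1 < p) (ha : a = 1/(p-1))
    (hq : q = p * n * a) {f : Fin m → (Fin m → ℝ) → ℝ} {b : Fin m → ℝ → ℝ}
    (fc : ∀ j, Continuous (f j)) (f0 : ∀ j s, 0 ≤ f j s) (fm : ∀ j, Monotone (f j))
    (fp : ∀ j s, (∀ l, 0 < s l) → 0 < f j s)
    (bc : ∀ j, Continuous (b j)) (b0 : ∀ j s, 0 ≤ b j s)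
    {v u : Fin m → ℝ → ℝ} (vc : ∀ i, Continuous (v i))
    (hu : ∀ i r, u i r = 1/m + ∫ t in (0:ℝ)..r, phiF n a (fun s => b i s * f i (fun j => v j s)) t)
    (hvu : ∀ i r, v i r ≤ u i r) {Bt : ℝ → ℝ} (Btc : Continuous Bt) (Bt0 : ∀ s, 0 ≤ Bt s)
    (hBt : ∀ i s r, 0 ≤ s → s ≤ r → s ^ q * b i s ≤ r ^ q * Bt r)
    {I M : ℝ} (hI : ∀ r, 0 ≤ r → ∫ t in (0:ℝ)..r, (Bt t) ^ (1/p) ≤ I) (hM1 : 1 ≤ M)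
    (hM : ∀ x, M ≤ x → m * (p/(p-1)) ^ (1/p) * I < ∫ s in (1:ℝ)..x, (Fsum m f s) ^ (-1/p))
    (i : Fin m) (r : ℝ) : u i r ≤ M := by
  have hp1 : 0 < p - 1 := by linarith
  have ha0 : 0 < a := by rw [ha]; positivity
  have hm0 : (0:ℝ) < m := by exact_mod_cast hm
  have hm1 : (1:ℝ) ≤ m := by exact_mod_cast hm
  set g : Fin m → ℝ → ℝ := fun i s => b i s * f i (fun j => v j s) with hgdef
  have gc : ∀ i, Continuous (g i) := fun i =>
    (bc i).mul ((fc i).comp (continuous_pi fun j => vc j))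
  have g0 : ∀ i s, 0 ≤ g i s := fun i s => mul_nonneg (b0 i s) (f0 i _)
  have pc : ∀ i, Continuous (phiF n a (g i)) := fun i => phiF_cont hn ha0 (gc i) (g0 i)
  have p0 : ∀ i t, 0 ≤ phiF n a (g i) t := fun i t => phiF_nonneg hn ha0 (g0 i) t
  rcases le_total r 0 with hr | hr
  · have : ∫ t in (0:ℝ)..r, phiF n a (g i) t = 0 := by
      rw [intervalIntegral.integral_congr (g := fun _ => (0:ℝ))]
      · simp
      · intro t ht
        rw [uIcc_of_ge hr] at ht
        exact phiF_neg hn ha0 _ ht.2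
    have h2 := hu i r
    change _ = _ + ∫ t in (0:ℝ)..r, phiF n a (g i) t at h2
    rw [h2, this, add_zero]
    exact le_trans (by rw [div_le_one hm0]; exact hm1) hM1
  have ud : ∀ i r, HasDerivAt (u i) (phiF n a (g i) r) r := by
    intro i r
    have : u i = fun r => 1/(m:ℝ) + ∫ t in (0:ℝ)..r, phiF n a (g i) t := funext (hu i)
    rw [this]
    exact ((pc i).integral_hasStrictDerivAt 0 r).hasDerivAt.const_add _
  have uβ : ∀ i r, 0 ≤ r → 1/(m:ℝ) ≤ u i r := by
    intro i r hr
    rw [hu i r]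
    have := intervalIntegral.integral_nonneg (μ := volume) hr fun t _ => p0 i t
    linarith
  set W : ℝ → ℝ := fun r => ∑ i, u i r with hW
  have Wd : ∀ r, HasDerivAt W (∑ i, phiF n a (g i) r) r := fun r =>
    HasDerivAt.fun_sum fun i _ => ud i r
  have uW : ∀ i r, 0 ≤ r → u i r ≤ W r := fun i r hr =>
    Finset.single_le_sum (f := fun i => u i r)
      (fun j _ => (by positivity : (0:ℝ) ≤ 1/m).trans (uβ j r hr)) (Finset.mem_univ i)
  have W1 : ∀ r, 0 ≤ r → 1 ≤ W r := by
    intro r hr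
    calc (1:ℝ) = ∑ i : Fin m, 1/(m:ℝ) := by simp; field_simp
      _ ≤ W r := Finset.sum_le_sum fun i _ => uβ i r hr
  have W0 : W 0 = 1 := by
    simp only [hW, hu, intervalIntegral.integral_same]
    simp; field_simp
  refine (uW i r hr).trans ?_
  by_contra hcon
  push Not at hcon
  have h1 := hM _ hcon.le
  have hFp : ∀ s, 0 < s → 0 < Fsum m f s := fun s hs => Fsum_pos hm fc fp hs
  have Gc : ContinuousOn (fun s => (Fsum m f s) ^ (-1/p)) (Ioi 0) := fun s hs =>
    ((Fsum_cont fc).continuousAt.rpow_const (Or.inl (hFp s hs).ne')).continuousWithinAt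
  have Wc : Continuous W := continuous_iff_continuousAt.2 fun t => (Wd t).continuousAt
  have dWc : Continuous (fun r => ∑ i, phiF n a (g i) r) :=
    continuous_finsetSum _ fun i _ => pc i
  have Wpos : ∀ t ∈ uIcc 0 r, W t ∈ Ioi 0 := by
    intro t ht
    rw [uIcc_of_le hr] at ht
    exact lt_of_lt_of_le one_pos (W1 t ht.1)
  have sub := intervalIntegral.integral_comp_mul_deriv' (a := 0) (b := r)
    (f := W) (f' := fun r => ∑ i, phiF n a (g i) r) (g := fun s => (Fsum m f s) ^ (-1/p))
    (fun t _ => Wd t) dWc.continuousOn (Gc.mono (by rintro _ ⟨t, ht, rfl⟩; exact Wpos t ht))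
  rw [W0] at sub
  rw [← sub] at h1
  have h2 : ∫ t in (0:ℝ)..r, ((fun s => (Fsum m f s) ^ (-1/p)) ∘ W) t * ∑ i, phiF n a (g i) t ≤
      ∫ t in (0:ℝ)..r, (m * (p/(p-1)) ^ (1/p)) * (Bt t) ^ (1/p) := by
    apply intervalIntegral.integral_mono_on_of_le_Ioo hr
    · apply ContinuousOn.intervalIntegrable
      exact (Gc.comp Wc.continuousOn Wpos).mul dWc.continuousOn
    · apply Continuous.intervalIntegrable
      exact continuous_const.mul (Btc.rpow_const fun _ => Or.inr (by positivity))
    · intro t ht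
      have hF := hFp (W t) (lt_of_lt_of_le one_pos (W1 t ht.1.le))
      simp only [Function.comp]
      have hs : ∑ i, phiF n a (g i) t ≤ m * ((p/(p-1)) ^ (1/p) * ((Bt t) ^ (1/p) *
          (Fsum m f (W t)) ^ (1/p))) := by
        calc _ ≤ ∑ i : Fin m, (p/(p-1) * (Bt t * Fsum m f (W t))) ^ (1/p) := by
              apply Finset.sum_le_sum
              intro i _
              exact energy hn hp ha hq fc f0 fm bc b0 (by positivity) vc hu hvu hBt i t ht.1
          _ = _ := by
              rw [Real.mul_rpow (by positivity) (mul_nonneg (Bt0 t) hF.le),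
                Real.mul_rpow (Bt0 t) hF.le]
              simp
      calc _ ≤ (Fsum m f (W t)) ^ (-1/p) * (m * ((p/(p-1)) ^ (1/p) * ((Bt t) ^ (1/p) *
          (Fsum m f (W t)) ^ (1/p)))) := by gcongr
        _ = ((Fsum m f (W t)) ^ (-1/p) * (Fsum m f (W t)) ^ (1/p)) *
            (m * (p/(p-1)) ^ (1/p) * (Bt t) ^ (1/p)) := by ring
        _ = _ := by rw [← Real.rpow_add hF]; ring_nf; simp
  rw [intervalIntegral.integral_const_mul] at h2
  have h3 := mul_le_mul_of_nonneg_left (hI r hr)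
    (by positivity : (0:ℝ) ≤ m * (p/(p-1)) ^ (1/p))
  linarith

noncomputable def iterW (m : ℕ) (n a : ℝ) (b : Fin m → ℝ → ℝ) (f : Fin m → (Fin m → ℝ) → ℝ) :
    ℕ → Fin m → ℝ → ℝ
  | 0 => fun _ _ => 1/m
  | k+1 => fun i r => 1/m + ∫ t in (0:ℝ)..r,
      phiF n a (fun s => b i s * f i (fun j => iterW m n a b f k j s)) t

lemma core {m : ℕ} (hm : 1 ≤ m) {n p a q : ℝ} (hn : 0 < n) (hp : 1 < p) (ha : a = 1/(p-1))
    (hq : q = p * n * a) {f : Fin m → (Fin m → ℝ) → ℝ} {b : Fin m → ℝ → ℝ}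
    (fc : ∀ j, Continuous (f j)) (f0 : ∀ j s, 0 ≤ f j s) (fm : ∀ j, Monotone (f j))
    (fp : ∀ j s, (∀ l, 0 < s l) → 0 < f j s)
    (bc : ∀ j, Continuous (b j)) (b0 : ∀ j s, 0 ≤ b j s)
    {Bt : ℝ → ℝ} (Btc : Continuous Bt) (Bt0 : ∀ s, 0 ≤ Bt s)
    (hBt : ∀ i s r, 0 ≤ s → s ≤ r → s ^ q * b i s ≤ r ^ q * Bt r)
    {I : ℝ} (hI : ∀ r, 0 ≤ r → ∫ t in (0:ℝ)..r, (Bt t) ^ (1/p) ≤ I)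
    (hf3 : SatC3 m p f) :
    ∃ (w : Fin m → ℝ → ℝ) (M : ℝ), (∀ i, Continuous (w i)) ∧ (∀ i r, 1/(m:ℝ) ≤ w i r) ∧
      (∀ i, Monotone (w i)) ∧ (∀ i r, w i r ≤ M) ∧
      ∀ i r, w i r = 1/m + ∫ t in (0:ℝ)..r, phiF n a (fun s => b i s * f i (fun j => w j s)) t := by
  have hp1 : 0 < p - 1 := by linarith
  have ha0 : 0 < a := by rw [ha]; positivity
  obtain ⟨M, hM1, hM⟩ : ∃ M, 1 ≤ M ∧ ∀ x, M ≤ x →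
      m * (p/(p-1)) ^ (1/p) * I < ∫ s in (1:ℝ)..x, (Fsum m f s) ^ (-1/p) := by
    have := (hf3.eventually (eventually_gt_atTop (m * (p/(p-1)) ^ (1/p) * I)))
    obtain ⟨M, hM⟩ := eventually_atTop.1 this
    exact ⟨max M 1, le_max_right _ _, fun x hx => hM x ((le_max_left _ _).trans hx)⟩
  set W := iterW m n a b f with hWdef
  set G : ℕ → Fin m → ℝ → ℝ := fun k i s => b i s * f i (fun j => W k j s) with hG
  have G0 : ∀ k i s, 0 ≤ G k i s := fun k i s => mul_nonneg (b0 i s) (f0 i _)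
  have Wsucc : ∀ k i r, W (k+1) i r = 1/m + ∫ t in (0:ℝ)..r, phiF n a (G k i) t := fun k i r => rfl
  have Gc_of : ∀ k, (∀ i, Continuous (W k i)) → ∀ i, Continuous (G k i) := fun k h i =>
    (bc i).mul ((fc i).comp (continuous_pi fun j => h j))
  have Wc : ∀ k i, Continuous (W k i) := by
    intro k
    induction k with
    | zero => exact fun i => continuous_const
    | succ k ih =>
      intro i
      have : W (k+1) i = fun r => 1/(m:ℝ) + ∫ t in (0:ℝ)..r, phiF n a (G k i) t :=
        funext (Wsucc k i)
      rw [this]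
      exact continuous_const.add (continuous_iff_continuousAt.2 fun r =>
        (((phiF_cont hn ha0 (Gc_of k ih i) (G0 k i)).integral_hasStrictDerivAt 0 r).hasDerivAt).continuousAt)
  have Gc : ∀ k i, Continuous (G k i) := fun k => Gc_of k (Wc k)
  have pc : ∀ k i, Continuous (phiF n a (G k i)) := fun k i => phiF_cont hn ha0 (Gc k i) (G0 k i)
  have p0 : ∀ k i t, 0 ≤ phiF n a (G k i) t := fun k i t => phiF_nonneg hn ha0 (G0 k i) t
  -- integrals vanish on the left
  have intneg : ∀ (g : ℝ → ℝ) (r : ℝ), r ≤ 0 → ∫ t in (0:ℝ)..r, phiF n a g t = 0 := by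
    intro g r hr
    rw [intervalIntegral.integral_congr (g := fun _ => (0:ℝ))]
    · simp
    · intro t ht
      rw [uIcc_of_ge hr] at ht
      exact phiF_neg hn ha0 _ ht.2
  have Wle : ∀ k i r, W k i r ≤ W (k+1) i r := by
    intro k
    induction k with
    | zero =>
      intro i r
      rw [Wsucc]
      have : 0 ≤ ∫ t in (0:ℝ)..r, phiF n a (G 0 i) t := by
        rcases le_total r 0 with hr | hr
        · rw [intneg _ r hr]
        · exact intervalIntegral.integral_nonneg hr fun t _ => p0 0 i t
      have h0 : W 0 i r = 1/m := rfl
      linarith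
    | succ k ih =>
      intro i r
      rw [Wsucc, Wsucc]
      rcases le_total r 0 with hr | hr
      · rw [intneg _ r hr, intneg _ r hr]
      · have := intervalIntegral.integral_mono_on hr ((pc k i).intervalIntegrable (μ := volume) 0 r)
          ((pc (k+1) i).intervalIntegrable 0 r) fun t _ => phiF_mono hn ha0 (Gc k i) (Gc (k+1) i)
            (G0 k i) (fun s => mul_le_mul_of_nonneg_left (fm i fun j => ih j s) (b0 i s)) t
        linarith
  have WM' : ∀ k i r, W (k+1) i r ≤ M := fun k i r =>
    apriori hm hn hp ha hq fc f0 fm fp bc b0 (Wc k) (Wsucc k) (Wle k) Btc Bt0 hBt hI hM1 hM i r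
  have WM : ∀ k i r, W k i r ≤ M := fun k i r => (Wle k i r).trans (WM' k i r)
  have Wmono : ∀ i r, Monotone fun k => W k i r := fun i r =>
    monotone_nat_of_le_succ fun k => Wle k i r
  have lim : ∀ i r, ∃ l, Tendsto (fun k => W k i r) atTop (nhds l) := fun i r =>
    ⟨_, tendsto_atTop_ciSup (Wmono i r) ⟨M, by rintro _ ⟨k, rfl⟩; exact WM k i r⟩⟩
  choose w hw using lim
  have wM : ∀ i r, w i r ≤ M := fun i r => le_of_tendsto' (hw i r) fun k => WM k i r
  have wβ : ∀ i r, 1/(m:ℝ) ≤ w i r := fun i r => (Wmono i r).ge_of_tendsto (hw i r) 0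
  have Glim : ∀ i s, Tendsto (fun k => G k i s) atTop (nhds (b i s * f i (fun j => w j s))) := by
    intro i s
    exact (((fc i).tendsto _).comp (tendsto_pi_nhds.2 fun j => hw j s)).const_mul (b i s)
  set GM : Fin m → ℝ → ℝ := fun i s => b i s * f i (fun _ => M) with hGM
  have GMc : ∀ i, Continuous (GM i) := fun i => (bc i).mul continuous_const
  have GM0 : ∀ i s, 0 ≤ GM i s := fun i s => mul_nonneg (b0 i s) (f0 i _)
  have GleM : ∀ k i s, G k i s ≤ GM i s := fun k i s =>
    mul_le_mul_of_nonneg_left (fm i fun j => WM k j s) (b0 i s)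
  set Gw : Fin m → ℝ → ℝ := fun i s => b i s * f i (fun j => w j s) with hGw
  have Gw0 : ∀ i s, 0 ≤ Gw i s := fun i s => mul_nonneg (b0 i s) (f0 i _)
  have Ylim : ∀ i t, Tendsto (fun k => Yf n (G k i) t) atTop (nhds (Yf n (Gw i) t)) := by
    intro i t
    apply intervalIntegral.tendsto_integral_filter_of_dominated_convergence
      (fun s => (max s 0) ^ n * GM i s)
    · exact Eventually.of_forall fun k => (Yint_cont hn (Gc k i)).aestronglyMeasurable
    · refine Eventually.of_forall fun k => Eventually.of_forall fun s _ => ?_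
      have h1 : (0:ℝ) ≤ (max s 0) ^ n := Real.rpow_nonneg (le_max_right _ _) _
      rw [Real.norm_of_nonneg (mul_nonneg h1 (G0 k i s))]
      exact mul_le_mul_of_nonneg_left (GleM k i s) h1
    · exact (Yint_cont hn (GMc i)).intervalIntegrable _ _
    · exact Eventually.of_forall fun s _ => (Glim i s).const_mul _
  have plim : ∀ i t, Tendsto (fun k => phiF n a (G k i) t) atTop (nhds (phiF n a (Gw i) t)) := by
    intro i t
    exact ((Ylim i t).const_mul _).rpow_const (Or.inr ha0.le)
  have ple : ∀ k i t, phiF n a (G k i) t ≤ phiF n a (GM i) t := fun k i t =>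
    phiF_mono hn ha0 (Gc k i) (GMc i) (G0 k i) (GleM k i) t
  have pMc : ∀ i, Continuous (phiF n a (GM i)) := fun i => phiF_cont hn ha0 (GMc i) (GM0 i)
  have pw0 : ∀ i t, 0 ≤ phiF n a (Gw i) t := fun i t => phiF_nonneg hn ha0 (Gw0 i) t
  have weq : ∀ i r, w i r = 1/m + ∫ t in (0:ℝ)..r, phiF n a (Gw i) t := by
    intro i r
    have h1 : Tendsto (fun k => ∫ t in (0:ℝ)..r, phiF n a (G k i) t) atTop
        (nhds (∫ t in (0:ℝ)..r, phiF n a (Gw i) t)) := by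
      apply intervalIntegral.tendsto_integral_filter_of_dominated_convergence (phiF n a (GM i))
      · exact Eventually.of_forall fun k => (pc k i).aestronglyMeasurable
      · refine Eventually.of_forall fun k => Eventually.of_forall fun s _ => ?_
        rw [Real.norm_of_nonneg (p0 k i s)]
        exact ple k i s
      · exact (pMc i).intervalIntegrable _ _
      · exact Eventually.of_forall fun s _ => plim i s
    exact tendsto_nhds_unique ((tendsto_add_atTop_iff_nat 1).2 (hw i r)) (h1.const_add (1/(m:ℝ)))
  have pwm : ∀ i, Measurable (phiF n a (Gw i)) := fun i =>
    measurable_of_tendsto_metrizable (fun k => (pc k i).measurable) (tendsto_pi_nhds.2 (plim i))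
  have pwI : ∀ i r s, IntervalIntegrable (phiF n a (Gw i)) volume r s := by
    intro i r s
    refine ((pMc i).intervalIntegrable r s).mono_fun (pwm i).aestronglyMeasurable ?_
    refine Eventually.of_forall fun t => ?_
    have h2 := le_of_tendsto' (plim i t) fun k => ple k i t
    simp only
    rw [Real.norm_of_nonneg (pw0 i t)]
    exact h2.trans (le_abs_self _)
  refine ⟨w, M, fun i => ?_, wβ, fun i r s hrs => ?_, wM, weq⟩
  · have : w i = fun r => 1/(m:ℝ) + ∫ t in (0:ℝ)..r, phiF n a (Gw i) t := funext (weq i)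
    rw [this]
    exact continuous_const.add (intervalIntegral.continuous_primitive (pwI i) 0)
  · rw [weq i r, weq i s, ← intervalIntegral.integral_add_adjacent_intervals (pwI i 0 r) (pwI i r s)]
    have := intervalIntegral.integral_nonneg (μ := volume) hrs fun t _ => pw0 i t
    linarith

lemma upper_aux {m : ℕ} {F : (Fin m → ℝ) → ℝ} (hF : Monotone F)
    (hs : ∀ s i, Continuous fun t => F (Function.update s i t)) (x : Fin m → ℝ) {ε : ℝ}
    (hε : 0 < ε) : ∃ δ > 0, F (fun l => x l + δ) < F x + ε := by
  suffices h : ∀ S : Finset (Fin m), ∃ δ > 0, F (fun l => if l ∈ S then x l + δ else x l) < F x + ε by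
    simpa using h Finset.univ
  intro S
  induction S using Finset.induction_on with
  | empty => exact ⟨1, one_pos, by simpa using hε⟩
  | insert i S hi ih =>
    obtain ⟨δ, hδ, h⟩ := ih
    set y : Fin m → ℝ := fun l => if l ∈ S then x l + δ else x l with hy
    have hyi : Function.update y i (x i) = y := by
      have : x i = y i := by simp [hy, hi]
      rw [this, Function.update_eq_self]
    have h1 : ∀ᶠ t in nhds (x i), F (Function.update y i t) < F x + ε := by
      apply (hs y i).continuousAt.eventually_lt_const
      simp only [hyi]; exact h
    obtain ⟨d, hd, hd'⟩ := Metric.eventually_nhds_iff.1 h1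
    refine ⟨min δ (d/2), by positivity, lt_of_le_of_lt (hF ?_) (hd' (y := x i + d/2) ?_)⟩
    · intro l
      by_cases hl : l = i
      · subst hl; simp
      · simp only [Finset.mem_insert, hl, false_or, ne_eq, not_false_eq_true,
          Function.update_of_ne, hy]
        split_ifs
        · linarith [min_le_left δ (d/2)]
        · exact le_rfl
    · rw [Real.dist_eq]; rw [add_sub_cancel_left, abs_of_pos (by positivity)]; linarith

lemma joint_cont {m : ℕ} {F : (Fin m → ℝ) → ℝ} (hF : Monotone F)
    (hs : ∀ s i, Continuous fun t => F (Function.update s i t)) : Continuous F := by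
  rw [Metric.continuous_iff']
  intro x ε hε
  obtain ⟨d, hd, h1⟩ := upper_aux hF hs x hε
  obtain ⟨d', hd', h2⟩ := upper_aux (F := fun s => -F (-s))
    (fun s t hst => neg_le_neg (hF (neg_le_neg hst)))
    (fun s i => by
      have : (fun t => -F (-Function.update s i t)) =
          fun t => -F (Function.update (-s) i (-t)) := by
        funext t; congr 2; funext l
        by_cases hl : l = i
        · subst hl; simp
        · simp [hl]
      rw [this]
      exact ((hs (-s) i).comp continuous_neg).neg) (-x) hε
  simp only [neg_neg] at h2
  filter_upwards [Metric.ball_mem_nhds x (lt_min hd hd')] with y hy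
  have hy' : ∀ l, |y l - x l| < min d d' := fun l =>
    lt_of_le_of_lt (by rw [← Real.dist_eq]; exact dist_le_pi_dist y x l) hy
  have u1 : F y ≤ F (fun l => x l + d) := hF fun l => by
    have := (abs_lt.1 (hy' l)).2
    have := min_le_left d d'
    simp only; linarith
  have u2 : F (-fun l => (-x) l + d') ≤ F y := hF fun l => by
    have := (abs_lt.1 (hy' l)).1
    have := min_le_right d d'
    simp only [Pi.neg_apply]; linarith
  rw [Real.dist_eq, abs_lt]
  constructor <;> linarith

lemma weight_bound {n p a q R K ε : ℝ} (hp : 1 < p) (hnp : p ≤ n) (ha : a = 1/(p-1))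
    (hq : q = p * n * a) (hR : 1 ≤ R) (hK : 0 ≤ K) (hε : 0 < ε) {B : ℝ → ℝ} (Bc : Continuous B)
    (B0 : ∀ s, 0 ≤ B s)
    (hint : IntegrableOn (fun t => t ^ (1+ε) * (B t) ^ (2/p)) (Set.Ioi 0)) :
    ∃ I, ∀ r, 0 ≤ r → ∫ t in (0:ℝ)..r, (K * (R / max R t) ^ q + B t) ^ (1/p) ≤ I := by
  have hp1 : 0 < p - 1 := by linarith
  have hp0 : 0 < p := by linarith
  have hR0 : 0 < R := by linarith
  have hq1 : 1 < q / p := by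
    rw [hq, ha]
    have : p * n * (1/(p-1)) / p = n / (p-1) := by field_simp
    rw [this, lt_div_iff₀ hp1]; linarith
  have hmax : ∀ t, 0 < max R t := fun t => lt_of_lt_of_le hR0 (le_max_left _ _)
  have g0 : ∀ t, 0 ≤ K * (R / max R t) ^ q + B t := fun t =>
    add_nonneg (mul_nonneg hK (Real.rpow_nonneg (div_nonneg hR0.le (hmax t).le) _)) (B0 t)
  have gc : Continuous fun t => (K * (R / max R t) ^ q + B t) ^ (1/p) := by
    refine Continuous.rpow_const ?_ fun _ => Or.inr (by positivity)
    refine (continuous_const.mul (Continuous.rpow_const ?_ fun t =>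
      Or.inl (div_pos hR0 (hmax t)).ne')).add Bc
    exact continuous_const.div (by fun_prop) fun t => (hmax t).ne'
  have key : IntegrableOn (fun t => (K * (R / max R t) ^ q + B t) ^ (1/p)) (Ioi 0) := by
    rw [← Ioc_union_Ioi_eq_Ioi hR0.le]
    refine IntegrableOn.union ?_ ?_
    · exact (gc.integrableOn_Icc (a := 0) (b := R)).mono_set Ioc_subset_Icc_self
    · have i1 : IntegrableOn (fun t : ℝ => (K ^ (1/p) * R ^ (q/p)) * t ^ (-(q/p))) (Ioi R) :=
        (integrableOn_Ioi_rpow_of_lt (by linarith) hR0).const_mul _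
      have i2 : IntegrableOn (fun t : ℝ => t ^ (-(1+ε))) (Ioi R) :=
        integrableOn_Ioi_rpow_of_lt (by linarith) hR0
      have i3 := hint.mono_set (Ioi_subset_Ioi hR0.le)
      refine Integrable.mono' ((i1.add i2).add i3) gc.aestronglyMeasurable ?_
      refine (ae_restrict_iff' measurableSet_Ioi).2 (Eventually.of_forall fun t ht => ?_)
      have ht : R < t := ht
      have ht0 : 0 < t := hR0.trans ht
      rw [Real.norm_of_nonneg (Real.rpow_nonneg (g0 t) _), max_eq_right ht.le]
      have hRt : 0 ≤ R / t := by positivity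
      have s1 : (K * (R / t) ^ q + B t) ^ (1/p) ≤ (K * (R / t) ^ q) ^ (1/p) + (B t) ^ (1/p) :=
        Real.rpow_add_le_add_rpow (by positivity) (B0 t) (by positivity)
          (by rw [div_le_one hp0]; exact hp.le)
      have s2 : (K * (R / t) ^ q) ^ (1/p) = (K ^ (1/p) * R ^ (q/p)) * t ^ (-(q/p)) := by
        rw [Real.mul_rpow hK (by positivity), ← Real.rpow_mul hRt, mul_one_div,
          Real.div_rpow hR0.le ht0.le, Real.rpow_neg ht0.le]
        ring
      have s3 : (B t) ^ (1/p) ≤ t ^ (-(1+ε)) + t ^ (1+ε) * (B t) ^ (2/p) := by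
        have e : (B t) ^ (2/p) = ((B t) ^ (1/p)) ^ 2 := by
          rw [← Real.rpow_natCast, ← Real.rpow_mul (B0 t)]; congr 1; push_cast; ring
        rw [e, Real.rpow_neg ht0.le]
        have hT : 0 < t ^ (1+ε) := by positivity
        set T := t ^ (1+ε)
        set z := (B t) ^ (1/p)
        have : T⁻¹ + T * z ^ 2 - z = T⁻¹ * ((1 - T * z / 2) ^ 2 + 3/4 * (T * z)^2) := by
          field_simp; ring
        have h0 : 0 ≤ T⁻¹ * ((1 - T * z / 2) ^ 2 + 3/4 * (T * z)^2) := by positivity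
        linarith
      simp only [Pi.add_apply]
      linarith
  refine ⟨∫ t in Ioi 0, (K * (R / max R t) ^ q + B t) ^ (1/p), fun r hr => ?_⟩
  rw [intervalIntegral.integral_of_le hr]
  exact setIntegral_mono_set key (Eventually.of_forall fun t => Real.rpow_nonneg (g0 t) _)
    (Eventually.of_forall fun t ht => ht.1)

/-- The theorem with a real exponent `ε`, as in the informal statement. -/
theorem stmt0_real (m N : ℕ) (p : ℝ) (hm : 1 ≤ m) (hN : 2 ≤ N)
    (hp1 : 1 < p) (hpN : p ≤ (N:ℝ) - 1)
    (f : Fin m → (Fin m → ℝ) → ℝ) (hf12 : SatC12 m f) (hf3 : SatC3 m p f)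
    (b : Fin m → ℝ → ℝ) (hbc : ∀ j, ContinuousOn (b j) (Set.Ici 0))
    (hbnn : ∀ j r, 0 ≤ r → 0 ≤ b j r)
    (hint : ∃ ε : ℝ, 0 < ε ∧ IntegrableOn
      (fun t => t ^ (1+ε) * (∑ j, b j t) ^ (2/p)) (Set.Ioi 0))
    (hmono : ∃ R₀ : ℝ, ∀ r s, R₀ ≤ r → r ≤ s →
      r ^ (p*((N:ℝ)-1)/(p-1)) * ∑ j, b j r ≤ s ^ (p*((N:ℝ)-1)/(p-1)) * ∑ j, b j s) :
    ∃ w : Fin m → ℝ → ℝ, IsRadialSolution m N p b f (1/m) w ∧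
      (∀ i, MonotoneOn (w i) (Set.Ici 0)) ∧
      (∀ i r, 0 ≤ r → 1/(m:ℝ) ≤ w i r) ∧
      (∀ i, ∃ M : ℝ, ∀ r, 0 ≤ r → w i r ≤ M) := by
  obtain ⟨fC, fnn, -, fpos, fmon⟩ := hf12
  obtain ⟨ε, hε, hint⟩ := hint
  obtain ⟨R₀, hR₀⟩ := hmono
  have hp0 : 0 < p := by linarith
  have hp1' : 0 < p - 1 := by linarith
  set n : ℝ := (N:ℝ) - 1 with hn_def
  have hn : 0 < n := by linarith
  set a : ℝ := 1/(p-1) with ha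
  set q : ℝ := p * n * a with hq
  have hq' : p * n / (p-1) = q := by rw [hq, ha]; ring
  have hq0 : 0 < q := by rw [hq, ha]; positivity
  rw [hq'] at hR₀
  let fe : Fin m → (Fin m → ℝ) → ℝ := fun j s => f j (fun l => max (s l) 0)
  let be : Fin m → ℝ → ℝ := fun j s => b j (max s 0)
  have be_eq : ∀ j s, 0 ≤ s → be j s = b j s := fun j s hs => by
    simp only [be, max_eq_left hs]
  have bc : ∀ j, Continuous (be j) := fun j =>
    (hbc j).comp_continuous (by fun_prop) fun s => mem_Ici.2 (le_max_right _ _)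
  have b0 : ∀ j s, 0 ≤ be j s := fun j s => hbnn j _ (le_max_right _ _)
  have f0 : ∀ j s, 0 ≤ fe j s := fun j s => fnn j _ fun l => le_max_right _ _
  have fm : ∀ j, Monotone (fe j) := fun j s t hst =>
    fmon j _ _ (fun l => le_max_right _ _) fun l => max_le_max_right 0 (hst l)
  have fp : ∀ j s, (∀ l, 0 < s l) → 0 < fe j s := fun j s hs =>
    fpos j _ fun l => lt_max_of_lt_left (hs l)
  have fc : ∀ j, Continuous (fe j) := by
    intro j
    refine joint_cont (fm j) fun s i => ?_
    have h1 := (fC j i (fun l => max (s l) 0) fun l => le_max_right _ _).continuousOn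
    have h2 := h1.comp_continuous (f := fun t : ℝ => max t 0) (by fun_prop)
      fun s => mem_Ici.2 (le_max_right _ _)
    convert h2 using 1
    funext t
    simp only [fe]
    congr 1; funext l
    by_cases hl : l = i
    · subst hl; simp
    · simp [hl]
  have Feq : ∀ s, 0 ≤ s → Fsum m fe s = Fsum m f s := by
    intro s hs
    apply intervalIntegral.integral_congr
    intro t ht
    rw [uIcc_of_le hs] at ht
    simp only [fe, max_eq_left ht.1]
  have hf3e : SatC3 m p fe := by
    refine Tendsto.congr' ?_ hf3
    filter_upwards [eventually_ge_atTop 1] with r hr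
    apply intervalIntegral.integral_congr
    intro s hs
    rw [uIcc_of_le hr] at hs
    simp only
    rw [Feq s (by linarith [hs.1])]
  set R := max R₀ 1 with hR
  have hR1 : 1 ≤ R := le_max_right _ _
  have hR0 : 0 < R := by linarith
  let B : ℝ → ℝ := fun s => ∑ j, be j s
  have Bc : Continuous B := continuous_finsetSum _ fun j _ => bc j
  have B0 : ∀ s, 0 ≤ B s := fun s => Finset.sum_nonneg fun j _ => b0 j s
  have B_eq : ∀ s, 0 ≤ s → B s = ∑ j, b j s := fun s hs =>
    Finset.sum_congr rfl fun j _ => be_eq j s hs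
  obtain ⟨K, hK⟩ := (isCompact_Icc (a := (0:ℝ)) (b := R)).exists_bound_of_continuousOn
    Bc.continuousOn
  have hK0 : 0 ≤ K := (norm_nonneg _).trans (hK 0 ⟨le_rfl, hR0.le⟩)
  have hKB : ∀ s, 0 ≤ s → s ≤ R → B s ≤ K := fun s h1 h2 => (le_abs_self _).trans (hK s ⟨h1, h2⟩)
  have hmax : ∀ t, 0 < max R t := fun t => lt_of_lt_of_le hR0 (le_max_left _ _)
  let Bt : ℝ → ℝ := fun t => K * (R / max R t) ^ q + B t
  have Bt0 : ∀ t, 0 ≤ Bt t := fun t =>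
    add_nonneg (mul_nonneg hK0 (Real.rpow_nonneg (div_nonneg hR0.le (hmax t).le) _)) (B0 t)
  have Btc : Continuous Bt := by
    refine (continuous_const.mul (Continuous.rpow_const ?_ fun t =>
      Or.inl (div_pos hR0 (hmax t)).ne')).add Bc
    exact continuous_const.div (by fun_prop) fun t => (hmax t).ne'
  have hBt : ∀ i s r, 0 ≤ s → s ≤ r → s ^ q * be i s ≤ r ^ q * Bt r := by
    intro i s r hs hsr
    have hr : 0 ≤ r := hs.trans hsr
    have h1 : be i s ≤ B s :=
      Finset.single_le_sum (f := fun j => be j s) (fun j _ => b0 j s) (Finset.mem_univ i)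
    have hsq : 0 ≤ s ^ q := Real.rpow_nonneg hs _
    have hrq : 0 ≤ r ^ q := Real.rpow_nonneg hr _
    refine (mul_le_mul_of_nonneg_left h1 hsq).trans ?_
    have h2 : r ^ q * Bt r = K * (r ^ q * (R / max R r) ^ q) + r ^ q * B r := by
      simp only [Bt]; ring
    rw [h2, ← Real.mul_rpow hr (div_nonneg hR0.le (hmax r).le)]
    have h3 : 0 ≤ r ^ q * B r := mul_nonneg hrq (B0 r)
    rcases le_total s R with hsR | hsR
    · have h4 : s ≤ r * (R / max R r) := by
        rcases le_total r R with hrR | hrR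
        · rw [max_eq_left hrR, div_self hR0.ne', mul_one]; exact hsr
        · rw [max_eq_right hrR]
          have : 0 < r := hR0.trans_le hrR
          rw [mul_div_cancel₀ _ this.ne']; exact hsR
      have h5 := Real.rpow_le_rpow hs h4 hq0.le
      have h6 := mul_le_mul h5 (hKB s hs hsR) (B0 s) (hsq.trans h5)
      linarith
    · have h7 := hR₀ s r ((le_max_left _ _).trans hsR) hsr
      rw [← B_eq s hs, ← B_eq r hr] at h7
      have h8 : 0 ≤ K * (r * (R / max R r)) ^ q :=
        mul_nonneg hK0 (Real.rpow_nonneg (mul_nonneg hr (div_nonneg hR0.le (hmax r).le)) _)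
      linarith
  have hint' : IntegrableOn (fun t => t ^ (1+ε) * (B t) ^ (2/p)) (Set.Ioi 0) := by
    refine hint.congr_fun (fun t ht => ?_) measurableSet_Ioi
    simp only
    rw [B_eq t (le_of_lt ht)]
  obtain ⟨I, hI⟩ := weight_bound hp1 hpN ha hq hR1 hK0 hε Bc B0 hint'
  obtain ⟨w, M, wc, wβ, wm, wM, weq⟩ :=
    core hm hn hp1 ha hq fc f0 fm fp bc b0 Btc Bt0 hBt hI hf3e
  have w0 : ∀ i r, 0 ≤ w i r := fun i r => (by positivity : (0:ℝ) ≤ 1/m).trans (wβ i r)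
  refine ⟨w, ⟨fun i => (wc i).continuousOn, fun i r _ => w0 i r, fun i r hr => ?_⟩,
    fun i => (wm i).monotoneOn _, fun i r _ => wβ i r, fun i => ⟨M, fun r _ => wM i r⟩⟩
  rw [weq i r]
  congr 1
  apply intervalIntegral.integral_congr
  intro t ht
  rw [uIcc_of_le hr] at ht
  have hY : Yf n (fun s => be i s * fe i (fun j => w j s)) t =
      ∫ s in (0:ℝ)..t, s ^ n * b i s * f i (fun j => w j s) := by
    apply intervalIntegral.integral_congr
    intro s hs
    rw [uIcc_of_le ht.1] at hs
    simp only [fe, max_eq_left hs.1, max_eq_left (w0 _ _), be_eq i s hs.1]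
    ring
  simp only [phiF]
  rw [hY, max_eq_left ht.1]
  have : -n = 1 - (N:ℝ) := by rw [hn_def]; ring
  rw [this]

theorem stmt0 (m N : ℕ) (p : ℝ) (hm : 1 ≤ m) (hN : 2 ≤ N)
    (hp1 : 1 < p) (hpN : p ≤ (N:ℝ) - 1)
    (f : Fin m → (Fin m → ℝ) → ℝ) (hf12 : SatC12 m f) (hf3 : SatC3 m p f)
    (b : Fin m → ℝ → ℝ) (hbc : ∀ j, ContinuousOn (b j) (Set.Ici 0))
    (hbnn : ∀ j r, 0 ≤ r → 0 ≤ b j r)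
    (hint : ∃ ε > 0, IntegrableOn
      (fun t => t ^ (1+ε) * (∑ j, b j t) ^ (2/p)) (Set.Ioi 0))
    (hmono : ∃ R₀ : ℝ, ∀ r s, R₀ ≤ r → r ≤ s →
      r ^ (p*((N:ℝ)-1)/(p-1)) * ∑ j, b j r ≤ s ^ (p*((N:ℝ)-1)/(p-1)) * ∑ j, b j s) :
    ∃ w : Fin m → ℝ → ℝ, IsRadialSolution m N p b f (1/m) w ∧
      (∀ i, MonotoneOn (w i) (Set.Ici 0)) ∧
      (∀ i r, 0 ≤ r → 1/(m:ℝ) ≤ w i r) ∧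
      (∀ i, ∃ M : ℝ, ∀ r, 0 ≤ r → w i r ≤ M) := by
  -- In the frozen statement the elaborator reads `ε` as a natural number; the version with
  -- real `ε` is `stmt0_real` above.
  obtain ⟨ε, hε, h⟩ := hint
  refine stmt0_real m N p hm hN hp1 hpN f hf12 hf3 b hbc hbnn
    ⟨((ε : ℕ) : ℝ), by exact_mod_cast hε, ?_⟩ hmono
  refine h.congr_fun (fun t _ => ?_) measurableSet_Ioi
  have : (1 + ((ε : ℕ) : ℝ)) = ((1 + ε : ℕ) : ℝ) := by push_cast; ring
  simp only
  rw [this, Real.rpow_natCast]
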